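/- arXiv:2006.06333 — 2 statements merged into one kernel-verified Lean document; each statement's English description precedes it below -/
import Mathlib

section
/- Suppose there exist two distinct vertices x_i, x_j of P, either both in E(P) or both in O(P), such that x_i and x_j are adjacent. Then D[V(P)] is a semicomplete digraph, and moreover x_s→x_t for all indices s, t with 1 ≤ t+1 < s ≤ k+2. -/
variable {V : Type*}

/-- Two vertices are adjacent in the digraph with arc relation `A`. -/
def DAdj (A : V → V → Prop) (x y : V) : Prop := A x y ∨ A y x

/-- `x 0, x 1, …, x n` is a directed path of length `n` (distinct vertices, consecutive arcs). -/
def IsDipathOn (A : V → V → Prop) (n : ℕ) (x : ℕ → V) : Prop :=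
  (∀ i j, i ≤ n → j ≤ n → x i = x j → i = j) ∧ ∀ i, i < n → A (x i) (x (i + 1))

/-- There is a directed path of length `n` from `u` to `v`. -/
def HasDipath (A : V → V → Prop) (n : ℕ) (u v : V) : Prop :=
  ∃ x : ℕ → V, IsDipathOn A n x ∧ x 0 = u ∧ x n = v

/-- A digraph is `k`-quasi-transitive if the endpoints of every path of length `k` are adjacent. -/
def KQuasiTransitive (A : V → V → Prop) (k : ℕ) : Prop :=
  ∀ x : ℕ → V, IsDipathOn A k x → DAdj A (x 0) (x k)

/-- A digraph is strong if every vertex is reachable from every other vertex. -/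
def StrongD (A : V → V → Prop) : Prop := ∀ u v : V, ∃ n, HasDipath A n u v

/-- The subdigraph induced on `S` is semicomplete. -/
def SemicompleteOn (A : V → V → Prop) (S : Set V) : Prop :=
  ∀ x ∈ S, ∀ y ∈ S, x ≠ y → DAdj A x y

/-- The subdigraph induced on `S` is semicomplete bipartite. -/
def SemicompleteBipartiteOn (A : V → V → Prop) (S : Set V) : Prop :=
  ∃ X Y : Set V, X ∪ Y = S ∧ X ∩ Y = ∅ ∧
    (∀ x ∈ X, ∀ y ∈ X, ¬ DAdj A x y) ∧
    (∀ x ∈ Y, ∀ y ∈ Y, ¬ DAdj A x y) ∧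
    (∀ x ∈ X, ∀ y ∈ Y, DAdj A x y)

/-- The subdigraph induced on `S` has no arcs. -/
def EmptyOn (A : V → V → Prop) (S : Set V) : Prop :=
  ∀ x ∈ S, ∀ y ∈ S, ¬ A x y

/-- The vertex set `{P 0, …, P n}` of a path. -/
def VertsUpTo (n : ℕ) (P : ℕ → V) : Set V := {w | ∃ i ≤ n, P i = w}

/-- The odd-indexed vertices among `{P 0, …, P n}`. -/
def OddVertsUpTo (n : ℕ) (P : ℕ → V) : Set V := {w | ∃ i, i ≤ n ∧ Odd i ∧ P i = w}

/-- The even-indexed vertices among `{P 0, …, P n}`. -/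
def EvenVertsUpTo (n : ℕ) (P : ℕ → V) : Set V := {w | ∃ i, i ≤ n ∧ Even i ∧ P i = w}

/-- `I`: vertices outside `S` receiving no arc from `S`. -/
def ISet (A : V → V → Prop) (S : Set V) : Set V :=
  {x | x ∉ S ∧ ∀ w ∈ S, ¬ A w x}

/-- `W`: vertices outside `S` sending no arc to `S`. -/
def WSet (A : V → V → Prop) (S : Set V) : Set V :=
  {x | x ∉ S ∧ ∀ w ∈ S, ¬ A x w}

/-- `B`: vertices outside `S` that are in neither `I` nor `W`. -/
def BSet (A : V → V → Prop) (S : Set V) : Set V :=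
  {x | x ∉ S ∧ x ∉ ISet A S ∧ x ∉ WSet A S}

/-- The arc relation `R` on the positions `0, …, k + 2` of a path: consecutive positions are joined
by forward arcs, and a path of length `k` on positions that ends at least two positions before its
start forces a backward arc. -/
structure BackClosed (R : ℕ → ℕ → Prop) (k : ℕ) : Prop where
  step : ∀ i, i < k + 2 → R i (i + 1)
  back : ∀ f : ℕ → ℕ, (∀ i, i ≤ k → f i ≤ k + 2) →
    (∀ i j, i ≤ k → j ≤ k → f i = f j → i = j) →
    (∀ i, i < k → R (f i) (f (i + 1))) → f k + 2 ≤ f 0 → R (f 0) (f k)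

namespace BackClosed

variable {R : ℕ → ℕ → Prop} {k : ℕ}

/-- The path `a, …, t, c, …, b`. -/
theorem two_segments (h : BackClosed R k) (a t c b : ℕ) (r1 : R t c)
    (hat : a ≤ t) (ht : t ≤ k + 2) (hcb : c ≤ b) (hba : b + 2 ≤ a)
    (hlen : t + b + 1 = k + a + c) : R a b := by
  let f : ℕ → ℕ := fun i => if i + a ≤ t then a + i else c + (i + a - t - 1)
  have f0 : f 0 = a := by simp only [f]; split_ifs <;> omega
  have fk : f k = b := by simp only [f]; split_ifs <;> omega
  rw [← f0, ← fk]
  refine h.back f ?_ ?_ ?_ (by omega)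
  · intro i hi
    simp only [f]; split_ifs <;> omega
  · intro i j hi hj
    simp only [f]; split_ifs <;> omega
  · intro i hi
    rcases lt_trichotomy (i + a) t with h1 | h1 | h1
    · have e1 : f i = a + i := by simp only [f]; split_ifs <;> omega
      have e2 : f (i + 1) = a + i + 1 := by simp only [f]; split_ifs <;> omega
      rw [e1, e2]; exact h.step _ (by omega)
    · have e1 : f i = t := by simp only [f]; split_ifs <;> omega
      have e2 : f (i + 1) = c := by simp only [f]; split_ifs <;> omega
      rw [e1, e2]; exact r1
    · have e1 : f i = c + (i + a - t - 1) := by simp only [f]; split_ifs <;> omega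
      have e2 : f (i + 1) = c + (i + a - t - 1) + 1 := by simp only [f]; split_ifs <;> omega
      rw [e1, e2]; exact h.step _ (by omega)

/-- The path `a, …, t, c, …, e, d, …, b`. -/
theorem three_segments (h : BackClosed R k) (a t c e d b : ℕ) (r1 : R t c) (r2 : R e d)
    (hat : a ≤ t) (ht : t ≤ k + 2) (hce : c ≤ e) (hea : e < a) (hdb : d ≤ b) (hbc : b < c)
    (hlen : t + e + b + 2 = k + a + c + d) : R a b := by
  let f : ℕ → ℕ := fun i => if i + a ≤ t then a + i else
    if i + a + c ≤ t + e + 1 then c + (i + a - t - 1) else d + (i + a + c - t - e - 2)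
  have f0 : f 0 = a := by simp only [f]; split_ifs <;> omega
  have fk : f k = b := by simp only [f]; split_ifs <;> omega
  rw [← f0, ← fk]
  refine h.back f ?_ ?_ ?_ (by omega)
  · intro i hi
    simp only [f]; split_ifs <;> omega
  · intro i j hi hj
    simp only [f]; split_ifs <;> omega
  · intro i hi
    rcases lt_trichotomy (i + a) t with h1 | h1 | h1
    · have e1 : f i = a + i := by simp only [f]; split_ifs <;> omega
      have e2 : f (i + 1) = a + i + 1 := by simp only [f]; split_ifs <;> omega
      rw [e1, e2]; exact h.step _ (by omega)
    · have e1 : f i = t := by simp only [f]; split_ifs <;> omega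
      have e2 : f (i + 1) = c := by simp only [f]; split_ifs <;> omega
      rw [e1, e2]; exact r1
    rcases lt_trichotomy (i + a + c) (t + e + 1) with h2 | h2 | h2
    · have e1 : f i = c + (i + a - t - 1) := by simp only [f]; split_ifs <;> omega
      have e2 : f (i + 1) = c + (i + a - t - 1) + 1 := by simp only [f]; split_ifs <;> omega
      rw [e1, e2]; exact h.step _ (by omega)
    · have e1 : f i = e := by simp only [f]; split_ifs <;> omega
      have e2 : f (i + 1) = d := by simp only [f]; split_ifs <;> omega
      rw [e1, e2]; exact r2
    · have e1 : f i = d + (i + a + c - t - e - 2) := by simp only [f]; split_ifs <;> omega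
      have e2 : f (i + 1) = d + (i + a + c - t - e - 2) + 1 := by
        simp only [f]; split_ifs <;> omega
      rw [e1, e2]; exact h.step _ (by omega)

/-- The path `a, …, t, c, …, e, d, …, g, m, …, b`. -/
theorem four_segments (h : BackClosed R k) (a t c e d g m b : ℕ)
    (r1 : R t c) (r2 : R e d) (r3 : R g m)
    (hat : a ≤ t) (ht : t ≤ k + 2) (hce : c ≤ e) (hea : e < a) (hdg : d ≤ g) (hgc : g < c)
    (hmb : m ≤ b) (hbd : b < d)
    (hlen : t + e + g + b + 3 = k + a + c + d + m) : R a b := by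
  let f : ℕ → ℕ := fun i => if i + a ≤ t then a + i else
    if i + a + c ≤ t + e + 1 then c + (i + a - t - 1) else
    if i + a + c + d ≤ t + e + g + 2 then d + (i + a + c - t - e - 2) else
      m + (i + a + c + d - t - e - g - 3)
  have f0 : f 0 = a := by simp only [f]; split_ifs <;> omega
  have fk : f k = b := by simp only [f]; split_ifs <;> omega
  rw [← f0, ← fk]
  refine h.back f ?_ ?_ ?_ (by omega)
  · intro i hi
    simp only [f]; split_ifs <;> omega
  · intro i j hi hj
    simp only [f]; split_ifs <;> omega
  · intro i hi
    rcases lt_trichotomy (i + a) t with h1 | h1 | h1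
    · have e1 : f i = a + i := by simp only [f]; split_ifs <;> omega
      have e2 : f (i + 1) = a + i + 1 := by simp only [f]; split_ifs <;> omega
      rw [e1, e2]; exact h.step _ (by omega)
    · have e1 : f i = t := by simp only [f]; split_ifs <;> omega
      have e2 : f (i + 1) = c := by simp only [f]; split_ifs <;> omega
      rw [e1, e2]; exact r1
    rcases lt_trichotomy (i + a + c) (t + e + 1) with h2 | h2 | h2
    · have e1 : f i = c + (i + a - t - 1) := by simp only [f]; split_ifs <;> omega
      have e2 : f (i + 1) = c + (i + a - t - 1) + 1 := by simp only [f]; split_ifs <;> omega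
      rw [e1, e2]; exact h.step _ (by omega)
    · have e1 : f i = e := by simp only [f]; split_ifs <;> omega
      have e2 : f (i + 1) = d := by simp only [f]; split_ifs <;> omega
      rw [e1, e2]; exact r2
    rcases lt_trichotomy (i + a + c + d) (t + e + g + 2) with h3 | h3 | h3
    · have e1 : f i = d + (i + a + c - t - e - 2) := by simp only [f]; split_ifs <;> omega
      have e2 : f (i + 1) = d + (i + a + c - t - e - 2) + 1 := by
        simp only [f]; split_ifs <;> omega
      rw [e1, e2]; exact h.step _ (by omega)
    · have e1 : f i = g := by simp only [f]; split_ifs <;> omega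
      have e2 : f (i + 1) = m := by simp only [f]; split_ifs <;> omega
      rw [e1, e2]; exact r3
    · have e1 : f i = m + (i + a + c + d - t - e - g - 3) := by
        simp only [f]; split_ifs <;> omega
      have e2 : f (i + 1) = m + (i + a + c + d - t - e - g - 3) + 1 := by
        simp only [f]; split_ifs <;> omega
      rw [e1, e2]; exact h.step _ (by omega)

theorem last_first (h : BackClosed R k) (hk : 5 ≤ k) (hk0 : R k 0) (hk2 : R (k + 2) 2) :
    R (k + 2) 0 :=
  h.three_segments (k + 2) (k + 2) 2 k 0 0 hk2 hk0
    (by omega) (by omega) (by omega) (by omega) (by omega) (by omega) (by omega)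

theorem back_three (h : BackClosed R k) (hk : 5 ≤ k) (hk0 : R k 0) (hk2 : R (k + 2) 2)
    {b : ℕ} (hb : b + 3 ≤ k + 2) : R (b + 3) b :=
  h.two_segments (b + 3) (k + 2) 0 b (h.last_first hk hk0 hk2)
    (by omega) (by omega) (by omega) (by omega) (by omega)

theorem last_even (h : BackClosed R k) (hk : 5 ≤ k) (hk0 : R k 0)
    (hk2 : R (k + 2) 2) (j : ℕ) : ∀ b, b + 3 + 2 * j = k + 2 → R (k + 2) b := by
  induction j with
  | zero =>
    intro b hb
    have := h.back_three hk hk0 hk2 (b := b) (by omega)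
    rwa [show b + 3 = k + 2 by omega] at this
  | succ j ih =>
    intro b hb
    exact h.three_segments (k + 2) (k + 2) (b + 2) k 0 b (ih (b + 2) (by omega)) hk0
      (by omega) (by omega) (by omega) (by omega) (by omega) (by omega) (by omega)

theorem odd_first (h : BackClosed R k) (hk : 5 ≤ k) (hk0 : R k 0)
    (hk2 : R (k + 2) 2) (j : ℕ) : 3 + 2 * j ≤ k + 2 → R (3 + 2 * j) 0 := by
  induction j with
  | zero => intro _; exact h.back_three hk hk0 hk2 (b := 0) (by omega)
  | succ j ih =>
    intro hj
    exact h.three_segments _ (k + 2) 2 (3 + 2 * j) 0 0 hk2 (ih (by omega))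
      (by omega) (by omega) (by omega) (by omega) (by omega) (by omega) (by omega)

/-- All backward arcs between positions of different parity are present. -/
theorem back_odd (h : BackClosed R k) (hk : 5 ≤ k) (hodd : k % 2 = 1) (hk0 : R k 0)
    (hk2 : R (k + 2) 2) {a b : ℕ} (ha : a ≤ k + 2) (hab : b + 3 ≤ a)
    (hpar : a % 2 ≠ b % 2) : R a b := by
  have to_first : ∀ a, 3 ≤ a → a ≤ k + 2 → a % 2 = 1 → R a 0 := by
    intro a h1 h2 h3
    have := h.odd_first hk hk0 hk2 ((a - 3) / 2) (by omega)
    rwa [show 3 + 2 * ((a - 3) / 2) = a by omega] at this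
  have from_last : ∀ b, b + 3 ≤ k + 2 → b % 2 = 0 → R (k + 2) b := fun b h1 h2 =>
    h.last_even hk hk0 hk2 ((k + 2 - 3 - b) / 2) b (by omega)
  rcases Nat.lt_or_ge a (b + 4) with hd | hd
  · obtain rfl : a = b + 3 := by omega
    exact h.back_three hk hk0 hk2 ha
  rcases Nat.mod_two_eq_zero_or_one a with hp | hp
  · exact h.three_segments a (k + 2) (b + 3) (a - 1) 0 b
      (from_last _ (by omega) (by omega)) (to_first _ (by omega) (by omega) (by omega))
      (by omega) (by omega) (by omega) (by omega) (by omega) (by omega) (by omega)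
  · exact h.three_segments a (k + 2) (b + 2) (a - 2) 0 b
      (from_last _ (by omega) (by omega)) (to_first _ (by omega) (by omega) (by omega))
      (by omega) (by omega) (by omega) (by omega) (by omega) (by omega) (by omega)

/-- A backward arc into position `q ≤ 1` can have its tail raised to the end of the path. -/
theorem raise_tail (h : BackClosed R k)
    (hR : ∀ a b, a ≤ k + 2 → b + 3 ≤ a → a % 2 ≠ b % 2 → R a b) {q p : ℕ} (hq : q ≤ 1)
    (hp : q + 2 ≤ p) (hpar : p % 2 = q % 2) (hr : R p q) (hk : 5 ≤ k) (hodd : k % 2 = 1)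
    (j : ℕ) : p + 2 * j ≤ k + 2 → R (p + 2 * j) q := by
  induction j with
  | zero => intro _; exact hr
  | succ j ih =>
    intro hj
    exact h.three_segments _ (k + 2) 2 (p + 2 * j) q q (hR _ _ (by omega) (by omega) (by omega))
      (ih (by omega))
      (by omega) (by omega) (by omega) (by omega) (by omega) (by omega) (by omega)

/-- A backward arc out of position `p ≥ k + 1` can have its head lowered to the start. -/
theorem lower_head (h : BackClosed R k) (hk0 : R k 0) {p q : ℕ} (hp : k + 1 ≤ p)
    (hp' : p ≤ k + 2) (j : ℕ) : q + 2 * j ≤ k → R p (q + 2 * j) → R p q := by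
  induction j with
  | zero => intro _ hr; exact hr
  | succ j ih =>
    intro hj hr
    refine ih (by omega) ?_
    exact h.three_segments p p (q + 2 * (j + 1)) k 0 (q + 2 * j) hr hk0
      (by omega) (by omega) (by omega) (by omega) (by omega) (by omega) (by omega)

/-- A same-parity backward arc yields one of the two longest same-parity backward arcs. -/
theorem exists_long_even (h : BackClosed R k) (hk : 5 ≤ k) (hodd : k % 2 = 1) (hk0 : R k 0)
    (hR : ∀ a b, a ≤ k + 2 → b + 3 ≤ a → a % 2 ≠ b % 2 → R a b) (q : ℕ) :
    ∀ p, p ≤ k + 2 → q + 2 ≤ p → p % 2 = q % 2 → R p q → R (k + 1) 0 ∨ R (k + 2) 1 := by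
  induction q using Nat.strong_induction_on with
  | _ q ih =>
    intro p hp hqp hpar hr
    rcases Nat.lt_or_ge k p with hpk | hpk
    · obtain rfl | rfl : p = k + 1 ∨ p = k + 2 := by omega
      · left
        refine h.lower_head hk0 le_rfl hp (q / 2) (by omega) ?_
        rwa [show 0 + 2 * (q / 2) = q by omega]
      · right
        refine h.lower_head hk0 (by omega) le_rfl ((q - 1) / 2) (by omega) ?_
        rwa [show 1 + 2 * ((q - 1) / 2) = q by omega]
    rcases Nat.lt_or_ge q 2 with hq | hq
    · have := h.raise_tail hR (by omega) hqp hpar hr hk hodd ((k + 2 - p) / 2) (by omega)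
      obtain rfl | rfl : q = 0 ∨ q = 1 := by omega
      · left
        rwa [show p + 2 * ((k + 2 - p) / 2) = k + 1 by omega] at this
      · right
        rwa [show p + 2 * ((k + 2 - p) / 2) = k + 2 by omega] at this
    · refine ih (q - 2) (by omega) (p + 2) (by omega) (by omega) (by omega) ?_
      exact h.four_segments (p + 2) (k + 2) (q + 2 - q % 2) p q (q + 2 - q % 2 - 1) 0 (q - 2)
        (hR _ _ (by omega) (by omega) (by omega)) hr (hR _ _ (by omega) (by omega) (by omega))
        (by omega) (by omega) (by omega) (by omega) (by omega) (by omega) (by omega) (by omega)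
        (by omega)

/-- Both of the longest same-parity backward arcs are present if one of them is. -/
theorem long_even (h : BackClosed R k) (hk : 5 ≤ k) (hodd : k % 2 = 1) (hk0 : R k 0)
    (hR : ∀ a b, a ≤ k + 2 → b + 3 ≤ a → a % 2 ≠ b % 2 → R a b)
    (hlong : R (k + 1) 0 ∨ R (k + 2) 1) : R (k + 1) 0 ∧ R (k + 2) 1 := by
  rcases hlong with hl | hl
  · refine ⟨hl, ?_⟩
    have h20 : R 2 0 := h.two_segments 2 (k + 1) 0 0 hl
      (by omega) (by omega) (by omega) (by omega) (by omega)
    have := h.raise_tail hR (by omega) (by omega) (by omega) h20 hk hodd ((k - 3) / 2) (by omega)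
    rw [show 2 + 2 * ((k - 3) / 2) = k - 1 by omega] at this
    exact h.three_segments (k + 2) (k + 2) 2 (k - 1) 0 1
      (hR _ _ (by omega) (by omega) (by omega)) this
      (by omega) (by omega) (by omega) (by omega) (by omega) (by omega) (by omega)
  · refine ⟨?_, hl⟩
    have hlast : R (k + 2) k := h.two_segments (k + 2) (k + 2) 1 k hl
      (by omega) (by omega) (by omega) (by omega) (by omega)
    have h3 : R (k + 2) 3 := by
      refine h.lower_head hk0 (by omega) le_rfl ((k - 3) / 2) (by omega) ?_
      rwa [show 3 + 2 * ((k - 3) / 2) = k by omega]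
    exact h.three_segments (k + 1) (k + 2) 3 k 0 0 h3 hk0
      (by omega) (by omega) (by omega) (by omega) (by omega) (by omega) (by omega)

/-- One same-parity backward arc forces all backward arcs. -/
theorem back_all (h : BackClosed R k) (hk : 5 ≤ k) (hodd : k % 2 = 1) (hk0 : R k 0)
    (hk2 : R (k + 2) 2) {p q : ℕ} (hp : p ≤ k + 2) (hqp : q + 2 ≤ p) (hpar : p % 2 = q % 2)
    (hr : R p q) {a b : ℕ} (ha : a ≤ k + 2) (hab : b + 2 ≤ a) : R a b := by
  have hR : ∀ a b, a ≤ k + 2 → b + 3 ≤ a → a % 2 ≠ b % 2 → R a b := fun _ _ =>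
    h.back_odd hk hodd hk0 hk2
  obtain ⟨hl0, hl1⟩ := h.long_even hk hodd hk0 hR
    (h.exists_long_even hk hodd hk0 hR q p hp hqp hpar hr)
  have two : ∀ b, b + 2 ≤ k + 2 → R (b + 2) b := by
    intro b hb
    rcases Nat.lt_or_ge b k with hbk | hbk
    · exact h.two_segments (b + 2) (k + 1) 0 b hl0
        (by omega) (by omega) (by omega) (by omega) (by omega)
    · exact h.two_segments (b + 2) (k + 2) 1 b hl1
        (by omega) (by omega) (by omega) (by omega) (by omega)
  have to_first : ∀ a, 2 ≤ a → a ≤ k + 2 → R a 0 := by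
    intro a h1 h2
    rcases Nat.mod_two_eq_zero_or_one a with hpa | hpa
    · have := h.raise_tail hR (by omega) (by omega) (by omega) (two 0 (by omega)) hk hodd
        ((a - 2) / 2) (by omega)
      rwa [show 0 + 2 + 2 * ((a - 2) / 2) = a by omega] at this
    · exact hR _ _ h2 (by omega) (by omega)
  have from_last : ∀ b, b ≤ k → R (k + 2) b := by
    intro b hb
    rcases Nat.mod_two_eq_zero_or_one b with hpb | hpb
    · exact hR _ _ le_rfl (by omega) (by omega)
    · refine h.lower_head hk0 (by omega) le_rfl ((k - b) / 2) (by omega) ?_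
      rw [show b + 2 * ((k - b) / 2) = k by omega]
      exact two k le_rfl
  by_cases hne : a % 2 = b % 2
  · rcases Nat.lt_or_ge a (b + 3) with hd | hd
    · obtain rfl : a = b + 2 := by omega
      exact two b ha
    rcases Nat.lt_or_ge a (k + 2) with hak | hak
    · exact h.three_segments a (k + 2) (b + 3) (a - 1) 0 b (from_last _ (by omega))
        (to_first _ (by omega) (by omega))
        (by omega) (by omega) (by omega) (by omega) (by omega) (by omega) (by omega)
    · obtain rfl : a = k + 2 := by omega
      exact from_last b (by omega)
  · exact hR _ _ ha (by omega) hne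

end BackClosed

/-- An arc between vertices of a shortest path never skips forward. -/
theorem IsDipathOn.not_forward_arc {A : V → V → Prop} {n : ℕ} {P : ℕ → V}
    (hP : IsDipathOn A n P) (hdist : ∀ m, m < n → ¬ HasDipath A m (P 0) (P n))
    {i j : ℕ} (hij : i + 2 ≤ j) (hj : j ≤ n) : ¬ A (P i) (P j) := by
  intro hA
  refine hdist (n - (j - i - 1)) (by omega)
    ⟨fun l => P (if l ≤ i then l else l + (j - i - 1)), ⟨?_, ?_⟩, by simp, ?_⟩
  · intro l m hl hm heq
    have := hP.1 _ _ (by split_ifs <;> omega) (by split_ifs <;> omega) heq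
    split_ifs at this <;> omega
  · intro l hl
    rcases lt_trichotomy l i with h | h | h
    · simp only [if_pos h.le, if_pos (Nat.succ_le_of_lt h)]
      exact hP.2 l (by omega)
    · subst h
      simp only [le_refl, if_true, if_neg (show ¬ l + 1 ≤ l by omega)]
      rwa [show l + 1 + (j - l - 1) = j by omega]
    · simp only [if_neg (show ¬ l ≤ i by omega), if_neg (show ¬ l + 1 ≤ i by omega)]
      rw [show l + 1 + (j - i - 1) = l + (j - i - 1) + 1 by omega]
      exact hP.2 _ (by omega)
  · simp only
    congr 1
    split_ifs <;> omega

theorem stmt_4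
    {V : Type*} [Fintype V] (A : V → V → Prop) (hirr : Irreflexive A)
    (k : ℕ) (hk5 : 5 ≤ k) (hkodd : Odd k)
    (hQT : KQuasiTransitive A k) (hstrong : StrongD A)
    (u v : V) (hdist : ∀ m, m < k + 2 → ¬ HasDipath A m u v)
    (P : ℕ → V) (hP : IsDipathOn A (k + 2) P) (hPu : P 0 = u) (hPv : P (k + 2) = v)
    (hij : ∃ i j : ℕ, i ≤ k + 2 ∧ j ≤ k + 2 ∧ i ≠ j ∧ i % 2 = j % 2 ∧
      DAdj A (P i) (P j)) :
    SemicompleteOn A (VertsUpTo (k + 2) P) ∧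
    ∀ s t : ℕ, 1 ≤ t + 1 → t + 1 < s → s ≤ k + 2 → A (P s) (P t) := by
  subst hPu hPv
  have hfwd : ∀ i j, i + 2 ≤ j → j ≤ k + 2 → ¬ A (P i) (P j) := fun i j h1 h2 =>
    hP.not_forward_arc hdist h1 h2
  have hback : BackClosed (fun i j => A (P i) (P j)) k := by
    refine ⟨hP.2, fun f hf hinj harc hlt => ?_⟩
    have := hQT (fun i => P (f i))
      ⟨fun i j hi hj h => hinj i j hi hj (hP.1 _ _ (hf i hi) (hf j hj) h), harc⟩
    exact this.resolve_right (hfwd _ _ hlt (hf 0 (by omega)))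
  have hlong : ∀ i, i ≤ 2 → A (P (k + i)) (P i) := by
    intro i hi
    have := hQT (fun j => P (j + i))
      ⟨fun j l hj hl h => by have := hP.1 _ _ (by omega) (by omega) h; omega,
        fun j hj => by
          simp only
          rw [show j + 1 + i = j + i + 1 by omega]
          exact hP.2 _ (by omega)⟩
    simp only [Nat.zero_add] at this
    exact this.resolve_left (hfwd _ _ (by omega) (by omega))
  obtain ⟨p, q, hp, hqp, hpar, hr⟩ :
      ∃ p q, p ≤ k + 2 ∧ q + 2 ≤ p ∧ p % 2 = q % 2 ∧ A (P p) (P q) := by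
    obtain ⟨i, j, hi, hj, hne, hpar, hadj⟩ := hij
    rcases Nat.lt_or_gt_of_ne hne with hlt | hlt
    · exact ⟨j, i, hj, by omega, hpar.symm,
        hadj.resolve_left (hfwd i j (by omega) hj)⟩
    · exact ⟨i, j, hi, by omega, hpar, hadj.resolve_right (hfwd j i (by omega) hi)⟩
  have hall : ∀ s t : ℕ, t + 2 ≤ s → s ≤ k + 2 → A (P s) (P t) := fun s t hts hs =>
    hback.back_all hk5 (Nat.odd_iff.mp hkodd) (hlong 0 (by omega)) (hlong 2 le_rfl)
      hp hqp hpar hr hs hts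
  have hadj : ∀ i j, i < j → j ≤ k + 2 → DAdj A (P i) (P j) := by
    intro i j hlt hj
    rcases Nat.lt_or_ge j (i + 2) with h | h
    · obtain rfl : j = i + 1 := by omega
      exact Or.inl (hP.2 i (by omega))
    · exact Or.inr (hall j i h hj)
  refine ⟨?_, fun s t _ hts hs => hall s t hts hs⟩
  rintro _ ⟨i, hi, rfl⟩ _ ⟨j, hj, rfl⟩ hne
  rcases lt_trichotomy i j with h | h | h
  · exact hadj i j h hj
  · exact absurd (congrArg P h) hne
  · exact (hadj j i h hi).symm
end

section
/- The induced subdigraph D[V(P)] is either a semicomplete digraph or a semicomplete bipartite digraph. -/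
variable {V : Type*}

/-- Some sequence `f 0, …, f c` of distinct indices at most `h` leads from `s` to `l`, each step
being either `i ↦ i + 1` or a step of `B`. -/
def IndexPath (B : ℕ → ℕ → Prop) (h s l c : ℕ) : Prop :=
  ∃ f : ℕ → ℕ, f 0 = s ∧ f c = l ∧ (∀ i ≤ c, f i ≤ h) ∧
    (∀ i j, i ≤ c → j ≤ c → f i = f j → i = j) ∧
    ∀ i < c, f (i + 1) = f i + 1 ∨ B (f i) (f (i + 1))

/-- The index path `s, s + 1, …, l`. -/
theorem IndexPath.block {B : ℕ → ℕ → Prop} {s l : ℕ} (hsl : s ≤ l) :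
    IndexPath B l s l (l - s) :=
  ⟨fun m => s + m, by simp, by simp; omega, fun i hi => by simp; omega,
    fun i j _ _ h => by simpa using h, fun i _ => Or.inl (by simp; omega)⟩

/-- Prepend the block `i, i + 1, …, t` to an index path all of whose indices are below `i`. -/
theorem IndexPath.cons {B : ℕ → ℕ → Prop} {h s l c : ℕ} (i t : ℕ) (hB : B t s) (hi : h < i)
    (hit : i ≤ t) (hp : IndexPath B h s l c) : IndexPath B t i l (t - i + 1 + c) := by
  obtain ⟨f, f0, fc, fh, finj, fstep⟩ := hp
  refine ⟨fun m => if m ≤ t - i then i + m else f (m - (t - i + 1)), by simp, ?_, ?_, ?_, ?_⟩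
  · have h1 : ¬ t - i + 1 + c ≤ t - i := by omega
    simpa [h1] using fc
  · intro m hm
    dsimp only
    split_ifs with h1
    · omega
    · have := fh (m - (t - i + 1)) (by omega)
      omega
  · intro p q hp hq
    dsimp only
    split_ifs with h1 h2 h2 <;> intro he
    · omega
    · have := fh (q - (t - i + 1)) (by omega)
      omega
    · have := fh (p - (t - i + 1)) (by omega)
      omega
    · have := finj _ _ (by omega) (by omega) he
      omega
  · intro m hm
    dsimp only
    rcases lt_trichotomy m (t - i) with h1 | h1 | h1
    · left
      rw [if_pos (by omega), if_pos (by omega)]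
      omega
    · right
      rw [if_pos (by omega), if_neg (by omega)]
      have h2 : m + 1 - (t - i + 1) = 0 := by omega
      have h3 : i + m = t := by omega
      rwa [h2, h3, f0]
    · rw [if_neg (by omega), if_neg (by omega)]
      have h2 : m + 1 - (t - i + 1) = m - (t - i + 1) + 1 := by omega
      rw [h2]
      exact fstep _ (by omega)

/-- A relation of backward steps on the indices `0, …, k + 2` that contains the steps
`i + k ↦ i` and every backward step of length at least two joining the ends of an index path
of length `k`. -/
structure BackwardClosed (B : ℕ → ℕ → Prop) (k : ℕ) : Prop where
  base : ∀ i ≤ 2, B (i + k) i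
  closed : ∀ {h i l c : ℕ}, IndexPath B h i l c → h ≤ k + 2 → c = k → l + 2 ≤ i → B i l

namespace BackwardClosed

variable {B : ℕ → ℕ → Prop} {k : ℕ}

theorem step_k_zero (H : BackwardClosed B k) : B k 0 := by simpa using H.base 0 (by omega)

theorem step_top_two (H : BackwardClosed B k) : B (k + 2) 2 := by
  simpa [add_comm] using H.base 2 le_rfl

theorem step_top_zero (H : BackwardClosed B k) (hk : 5 ≤ k) : B (k + 2) 0 :=
  H.closed (.cons (k + 2) (k + 2) H.step_top_two (by omega) le_rfl
    (.cons 2 k H.step_k_zero (by omega) (by omega) (.block le_rfl)))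
    le_rfl (by omega) (by omega)

theorem step_three (H : BackwardClosed B k) (hk : 5 ≤ k) {l : ℕ} (hl : l + 3 ≤ k + 2) :
    B (l + 3) l :=
  H.closed (.cons (l + 3) (k + 2) (H.step_top_zero hk) (by omega) hl (.block (Nat.zero_le l)))
    le_rfl (by omega) (by omega)

theorem raise_source (H : BackwardClosed B k) {a l : ℕ} (hl : l ≤ 1) (ha : 2 ≤ a)
    (hak : a ≤ k) (hB : B a l) : B (a + 2) l :=
  H.closed (.cons (a + 2) (k + 2) H.step_top_two (by omega) (by omega)
    (.cons 2 a hB (by omega) ha (.block le_rfl)))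
    le_rfl (by omega) (by omega)

theorem lower_target (H : BackwardClosed B k) {a b : ℕ} (ha : k + 1 ≤ a) (hak : a ≤ k + 2)
    (hb : b + 2 ≤ k) (hB : B a (b + 2)) : B a b :=
  H.closed (.cons a a hB (by omega) le_rfl
    (.cons (b + 2) k H.step_k_zero (by omega) hb (.block (Nat.zero_le b))))
    hak (by omega) (by omega)

theorem raise_source_mul (H : BackwardClosed B k) {a l : ℕ} (hl : l ≤ 1) (ha : 2 ≤ a)
    (hB : B a l) (m : ℕ) (hm : a + 2 * m ≤ k + 2) : B (a + 2 * m) l := by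
  induction m with
  | zero => exact hB
  | succ m ih =>
    exact H.raise_source (a := a + 2 * m) hl (by omega) (by omega) (ih (by omega))

theorem lower_target_mul (H : BackwardClosed B k) {a b : ℕ} (ha : k + 1 ≤ a) (hak : a ≤ k + 2)
    (m : ℕ) (hb : b + 2 * m ≤ k) (hB : B a (b + 2 * m)) : B a b := by
  induction m with
  | zero => exact hB
  | succ m ih => exact ih (by omega) (H.lower_target ha hak (by omega) hB)

theorem step_to_low (H : BackwardClosed B k) (hk : 5 ≤ k) {i l : ℕ} (hl : l ≤ 1)
    (hil : l + 3 ≤ i) (hi : i ≤ k + 2) (hpar : (i + l) % 2 = 1) : B i l := by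
  have := H.raise_source_mul hl (by omega) (H.step_three hk (by omega)) ((i - (l + 3)) / 2)
    (by omega)
  rwa [show l + 3 + 2 * ((i - (l + 3)) / 2) = i by omega] at this

theorem step_from_high (H : BackwardClosed B k) (hk : 5 ≤ k) {i l : ℕ} (hi : k + 1 ≤ i)
    (hil : l + 3 ≤ i) (hik : i ≤ k + 2) (hpar : (i + l) % 2 = 1) : B i l := by
  refine H.lower_target_mul hi hik ((i - (l + 3)) / 2) (by omega) ?_
  have := H.step_three hk (l := i - 3) (by omega)
  rw [show i - 3 + 3 = i by omega] at this
  rwa [show l + 2 * ((i - (l + 3)) / 2) = i - 3 by omega]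

theorem step_of_odd (H : BackwardClosed B k) (hk : 5 ≤ k) (hodd : k % 2 = 1) {i l : ℕ}
    (hil : l + 3 ≤ i) (hi : i ≤ k + 2) (hpar : (i + l) % 2 = 1) : B i l := by
  rcases Nat.lt_or_ge i (l + 5) with h | h
  · obtain rfl : i = l + 3 := by omega
    exact H.step_three hk hi
  have low : ∀ j, 3 ≤ j → j ≤ k + 2 → j % 2 = 1 → B j 0 := fun j h1 h2 h3 =>
    H.step_to_low hk (by omega) (by omega) h2 (by omega)
  rcases Nat.mod_two_eq_zero_or_one i with hi2 | hi2
  · exact H.closed (.cons i (k + 1)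
      (H.step_from_high hk le_rfl (l := l + 2) (by omega) (by omega) (by omega))
      (by omega) (by omega) (.cons (l + 2) (i - 1) (low _ (by omega) (by omega) (by omega))
        (by omega) (by omega) (.block (Nat.zero_le l))))
      (by omega) (by omega) (by omega)
  · exact H.closed (.cons i (k + 2)
      (H.step_from_high hk (by omega) (l := l + 2) (by omega) (by omega) (by omega))
      (by omega) (by omega) (.cons (l + 2) (i - 2) (low _ (by omega) (by omega) (by omega))
        (by omega) (by omega) (.block (Nat.zero_le l))))
      (by omega) (by omega) (by omega)

theorem step_two_zero (H : BackwardClosed B k) (hk : 5 ≤ k) (hB : B (k + 1) 0) : B 2 0 :=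
  H.closed (.cons 2 (k + 1) hB (by omega) (by omega) (.block le_rfl))
    (by omega) (by omega) (by omega)

theorem step_of_even_of_step_two_zero (H : BackwardClosed B k) (hk : 5 ≤ k) (hodd : k % 2 = 1)
    (hB : B 2 0) {i l : ℕ} (hil : l + 2 ≤ i) (hi : i ≤ k + 2) (hpar : (i + l) % 2 = 0) :
    B i l := by
  have odd : ∀ {i l : ℕ}, l + 3 ≤ i → i ≤ k + 2 → (i + l) % 2 = 1 → B i l :=
    fun h1 h2 h3 => H.step_of_odd hk hodd h1 h2 h3
  have zero : ∀ j, 2 ≤ j → j ≤ k + 2 → j % 2 = 0 → B j 0 := fun j h1 h2 h3 => by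
    have := H.raise_source_mul (by omega) le_rfl hB ((j - 2) / 2) (by omega)
    rwa [show 2 + 2 * ((j - 2) / 2) = j by omega] at this
  have three_one : B 3 1 :=
    H.closed (.cons 3 k (odd (by omega) (by omega) (by omega)) (by omega) (by omega)
      (.cons 2 2 hB (by omega) le_rfl (.block (Nat.zero_le 1))))
      (by omega) (by omega) (by omega)
  have one : ∀ j, 3 ≤ j → j ≤ k + 2 → j % 2 = 1 → B j 1 := fun j h1 h2 h3 => by
    have := H.raise_source_mul le_rfl (by omega) three_one ((j - 3) / 2) (by omega)
    rwa [show 3 + 2 * ((j - 3) / 2) = j by omega] at this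
  rcases Nat.lt_or_ge l 2 with hl | hl
  · obtain rfl | rfl : l = 0 ∨ l = 1 := by omega
    · exact zero i hil hi (by omega)
    · exact one i hil hi (by omega)
  have top_one : B (k + 2) 1 := one _ (by omega) le_rfl (by omega)
  rcases Nat.lt_or_ge i (l + 4) with h | h
  · exact H.closed (.cons i (k + 2) top_one (by omega) (by omega) (.block (by omega)))
      le_rfl (by omega) (by omega)
  rcases Nat.mod_two_eq_zero_or_one i with hi2 | hi2
  · exact H.closed (.cons i (k + 2) (odd (l := l + 2) (by omega) (by omega) (by omega))
      (by omega) (by omega) (.cons (l + 2) (i - 1) (one _ (by omega) (by omega) (by omega))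
        (by omega) (by omega) (.block (by omega))))
      (by omega) (by omega) (by omega)
  · exact H.closed (.cons i (k + 2) (odd (l := l + 1) (by omega) (by omega) (by omega))
      (by omega) (by omega) (.cons (l + 1) (i - 2) (one _ (by omega) (by omega) (by omega))
        (by omega) (by omega) (.block (by omega))))
      (by omega) (by omega) (by omega)

theorem step_top_sub_one_zero_of_low (H : BackwardClosed B k) (hk : 5 ≤ k) (hodd : k % 2 = 1)
    {a b : ℕ} (hb : b ≤ 1) (hab : b + 2 ≤ a) (ha : a ≤ k + 2) (hpar : (a + b) % 2 = 0)
    (hB : B a b) : B (k + 1) 0 := by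
  have h := H.raise_source_mul hb (by omega) hB ((k + 1 + b - a) / 2) (by omega)
  rw [show a + 2 * ((k + 1 + b - a) / 2) = k + 1 + b by omega] at h
  obtain rfl | rfl : b = 0 ∨ b = 1 := by omega
  · exact h
  · exact H.closed (.cons (k + 1) (k + 2) h (by omega) (by omega)
      (.cons 1 (k - 2) (H.step_of_odd hk hodd (by omega) (by omega) (by omega))
        (by omega) (by omega) (.block le_rfl)))
      le_rfl (by omega) (by omega)

theorem step_top_sub_one_zero (H : BackwardClosed B k) (hk : 5 ≤ k) (hodd : k % 2 = 1)
    {a b : ℕ} (hab : b + 2 ≤ a) (ha : a ≤ k + 2) (hpar : (a + b) % 2 = 0) (hB : B a b) :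
    B (k + 1) 0 := by
  have odd : ∀ {i l : ℕ}, l + 3 ≤ i → i ≤ k + 2 → (i + l) % 2 = 1 → B i l :=
    fun h1 h2 h3 => H.step_of_odd hk hodd h1 h2 h3
  rcases Nat.lt_or_ge b 2 with hb | hb
  · exact H.step_top_sub_one_zero_of_low hk hodd (by omega) hab ha hpar hB
  rcases Nat.lt_or_ge k a with hka | hka
  · refine H.step_top_sub_one_zero_of_low hk hodd (b := b % 2) (by omega) (by omega) ha
      (by omega) (H.lower_target_mul hka ha (b / 2) (by omega) ?_)
    rwa [show b % 2 + 2 * (b / 2) = b by omega]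
  rcases Nat.mod_two_eq_zero_or_one a with ha2 | ha2
  · have h : B (a + 2) 0 := by
      obtain rfl | hb4 : b = 2 ∨ 4 ≤ b := by omega
      · exact H.closed (.cons (a + 2) (k + 2) (odd (l := 4) (by omega) (by omega) (by omega))
          (by omega) (by omega) (.cons 4 a hB (by omega) (by omega)
            (.cons 2 3 (odd (by omega) (by omega) (by omega)) (by omega) (by omega)
              (.block le_rfl))))
          le_rfl (by omega) (by omega)
      · exact H.closed (.cons (a + 2) (k + 2)
          (odd (l := b + 2) (by omega) (by omega) (by omega))
          (by omega) (by omega) (.cons (b + 2) a hB (by omega) (by omega)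
            (.cons b (b + 1) (odd (l := 2) (by omega) (by omega) (by omega)) (by omega) (by omega)
              (.cons 2 (b - 1) (odd (by omega) (by omega) (by omega)) (by omega) (by omega)
                (.block le_rfl)))))
          le_rfl (by omega) (by omega)
    exact H.step_top_sub_one_zero_of_low hk hodd (by omega) (by omega) (by omega) (by omega) h
  · have h : B (a + 1) 0 := by
      obtain rfl | hb5 : b = 3 ∨ 5 ≤ b := by omega
      · exact H.closed (.cons (a + 1) (k + 2) (odd (l := 4) (by omega) (by omega) (by omega))
          (by omega) (by omega) (.cons 4 a hB (by omega) (by omega)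
            (.cons 3 3 (odd (by omega) (by omega) (by omega)) (by omega) (by omega)
              (.block le_rfl))))
          le_rfl (by omega) (by omega)
      · exact H.closed (.cons (a + 1) (k + 2)
          (odd (l := b + 1) (by omega) (by omega) (by omega))
          (by omega) (by omega) (.cons (b + 1) a hB (by omega) (by omega)
            (.cons b b (odd (l := 2) (by omega) (by omega) (by omega)) (by omega) (by omega)
              (.cons 2 (b - 2) (odd (by omega) (by omega) (by omega)) (by omega) (by omega)
                (.block le_rfl)))))
          le_rfl (by omega) (by omega)
    exact H.step_top_sub_one_zero_of_low hk hodd (by omega) (by omega) (by omega) (by omega) h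

/-- A single backward step of even length forces all backward steps. -/
theorem step_of_exists_even (H : BackwardClosed B k) (hk : 5 ≤ k) (hodd : k % 2 = 1)
    {a b : ℕ} (hab : b + 2 ≤ a) (ha : a ≤ k + 2) (hpar : (a + b) % 2 = 0) (hB : B a b)
    {i l : ℕ} (hil : l + 2 ≤ i) (hi : i ≤ k + 2) : B i l := by
  rcases Nat.mod_two_eq_zero_or_one (i + l) with h | h
  · exact H.step_of_even_of_step_two_zero hk hodd
      (H.step_two_zero hk (H.step_top_sub_one_zero hk hodd hab ha hpar hB)) hil hi h
  · exact H.step_of_odd hk hodd (by omega) hi h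

end BackwardClosed

/-- A shortest path has no forward arc that skips a vertex. -/
theorem IsDipathOn.not_arc_of_shortest {V : Type*} {A : V → V → Prop} {n : ℕ} {P : ℕ → V}
    (hP : IsDipathOn A n P) (hmin : ∀ m < n, ¬ HasDipath A m (P 0) (P n)) {i j : ℕ}
    (hij : i + 2 ≤ j) (hj : j ≤ n) : ¬ A (P i) (P j) := by
  intro hA
  refine hmin (n - (j - i - 1)) (by omega)
    ⟨fun m => P (if m ≤ i then m else m + (j - i - 1)), ⟨?_, ?_⟩, by simp, ?_⟩
  · intro p q hp hq he
    have := hP.1 _ _ (by split_ifs <;> omega) (by split_ifs <;> omega) he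
    split_ifs at this <;> omega
  · intro m hm
    dsimp only
    rcases lt_trichotomy m i with h | h | h
    · rw [if_pos (by omega), if_pos (by omega)]
      exact hP.2 m (by omega)
    · rw [if_pos (by omega), if_neg (by omega), h, show i + 1 + (j - i - 1) = j by omega]
      exact hA
    · rw [if_neg (by omega), if_neg (by omega),
        show m + 1 + (j - i - 1) = m + (j - i - 1) + 1 by omega]
      exact hP.2 _ (by omega)
  · dsimp only
    rw [if_neg (by omega), show n - (j - i - 1) + (j - i - 1) = n by omega]

/-- The backward arcs along a shortest path of length `k + 2` in a `k`-quasi-transitive digraph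
form a `BackwardClosed` relation. -/
theorem KQuasiTransitive.backwardClosed {V : Type*} {A : V → V → Prop} {k : ℕ} (hk : 2 ≤ k)
    (hQT : KQuasiTransitive A k) {P : ℕ → V} (hP : IsDipathOn A (k + 2) P)
    (hno : ∀ {i j}, i + 2 ≤ j → j ≤ k + 2 → ¬ A (P i) (P j)) :
    BackwardClosed (fun i l => A (P i) (P l)) k where
  base i hi := by
    have h := hQT (fun m => P (i + m))
      ⟨fun p q hp hq he => by have := hP.1 _ _ (by omega) (by omega) he; omega,
        fun m hm => hP.2 (i + m) (by omega)⟩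
    rcases h with h | h
    · exact absurd h (hno (by omega) (by omega))
    · simpa [add_comm] using h
  closed := by
    rintro h i l c ⟨f, rfl, rfl, fh, finj, fstep⟩ hh rfl hil
    have hadj := hQT (fun m => P (f m))
      ⟨fun p q hp hq he => finj _ _ hp hq
        (hP.1 _ _ ((fh p hp).trans hh) ((fh q hq).trans hh) he), fun m hm => by
        rcases fstep m hm with hs | hs
        · have := fh (m + 1) (by omega)
          dsimp only
          rw [hs]
          exact hP.2 _ (by omega)
        · exact hs⟩
    rcases hadj with hA | hA
    · exact hA
    · exact absurd hA (hno hil ((fh 0 (Nat.zero_le _)).trans hh))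

theorem stmt_5
    {V : Type*} [Fintype V] (A : V → V → Prop) (hirr : Irreflexive A)
    (k : ℕ) (hk5 : 5 ≤ k) (hkodd : Odd k)
    (hQT : KQuasiTransitive A k) (hstrong : StrongD A)
    (u v : V) (hdist : ∀ m, m < k + 2 → ¬ HasDipath A m u v)
    (P : ℕ → V) (hP : IsDipathOn A (k + 2) P) (hPu : P 0 = u) (hPv : P (k + 2) = v) :
    SemicompleteOn A (VertsUpTo (k + 2) P) ∨
      SemicompleteBipartiteOn A (VertsUpTo (k + 2) P) := by
  subst hPu hPv
  obtain ⟨r, hr⟩ := hkodd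
  have hodd : k % 2 = 1 := by omega
  have hno : ∀ {i j}, i + 2 ≤ j → j ≤ k + 2 → ¬ A (P i) (P j) :=
    fun h1 h2 => hP.not_arc_of_shortest hdist h1 h2
  have H := hQT.backwardClosed (by omega) hP hno
  by_cases hev : ∃ a b, b + 2 ≤ a ∧ a ≤ k + 2 ∧ (a + b) % 2 = 0 ∧ A (P a) (P b)
  · left
    obtain ⟨a, b, hab, ha, hpar, hB⟩ := hev
    have key : ∀ i j, i < j → j ≤ k + 2 → DAdj A (P i) (P j) := fun i j hij hj => by
      rcases Nat.lt_or_ge j (i + 2) with h | h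
      · obtain rfl : j = i + 1 := by omega
        exact Or.inl (hP.2 i (by omega))
      · exact Or.inr (H.step_of_exists_even hk5 hodd hab ha hpar hB h hj)
    rintro _ ⟨i, hi, rfl⟩ _ ⟨j, hj, rfl⟩ hne
    rcases lt_trichotomy i j with h | rfl | h
    · exact key i j h hj
    · exact absurd rfl hne
    · exact (key j i h hi).symm
  · right
    have hsame : ∀ i j, i ≤ k + 2 → j ≤ k + 2 → (i + j) % 2 = 0 → ¬ A (P i) (P j) := by
      intro i j hi hj hpar hA
      rcases lt_trichotomy i j with h | rfl | h
      · exact hno (by omega) hj hA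
      · exact hirr _ hA
      · exact hev ⟨i, j, by omega, hi, hpar, hA⟩
    have hcross : ∀ i j, i < j → j ≤ k + 2 → (i + j) % 2 = 1 → DAdj A (P i) (P j) := by
      intro i j hij hj hpar
      rcases Nat.lt_or_ge j (i + 2) with h | h
      · obtain rfl : j = i + 1 := by omega
        exact Or.inl (hP.2 i (by omega))
      · exact Or.inr (H.step_of_odd hk5 hodd (by omega) hj (by omega))
    refine ⟨EvenVertsUpTo (k + 2) P, OddVertsUpTo (k + 2) P, ?_, ?_, ?_, ?_, ?_⟩
    · ext w
      constructor
      · rintro (⟨i, hi, -, rfl⟩ | ⟨i, hi, -, rfl⟩) <;> exact ⟨i, hi, rfl⟩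
      · rintro ⟨i, hi, rfl⟩
        rcases Nat.even_or_odd i with h | h
        · exact Or.inl ⟨i, hi, h, rfl⟩
        · exact Or.inr ⟨i, hi, h, rfl⟩
    · refine Set.eq_empty_of_forall_notMem ?_
      rintro _ ⟨⟨i, hi, hie, rfl⟩, j, hj, hjo, hji⟩
      obtain rfl := hP.1 _ _ hj hi hji
      exact (Nat.not_even_iff_odd.2 hjo) hie
    · rintro _ ⟨i, hi, ⟨p, hp⟩, rfl⟩ _ ⟨j, hj, ⟨q, hq⟩, rfl⟩ (h | h)
      · exact hsame i j hi hj (by omega) h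
      · exact hsame j i hj hi (by omega) h
    · rintro _ ⟨i, hi, ⟨p, hp⟩, rfl⟩ _ ⟨j, hj, ⟨q, hq⟩, rfl⟩ (h | h)
      · exact hsame i j hi hj (by omega) h
      · exact hsame j i hj hi (by omega) h
    · rintro _ ⟨i, hi, ⟨p, hp⟩, rfl⟩ _ ⟨j, hj, ⟨q, hq⟩, rfl⟩
      rcases Nat.lt_or_ge i j with h | h
      · exact hcross i j h hj (by omega)
      · exact (hcross j i (by omega) hi (by omega)).symm
end
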